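/- Let k be algebraically closed and n ≥ 1. There exist no r ≥ 1 and r×r matrices C, D over B, with all entries of C and D in the k-span of {x, y, xy, yx}, satisfying ν(C)D = wI_r and DC = wI_r, such that the image of the left A-linear map Aʳ → Aʳ given by right multiplication by the reduction of C modulo w is isomorphic as a left A-module to C_n(0). That is, C_n(0) does not arise from any twisted matrix factorization of w over B. -/

import Mathlib

noncomputable section
open FreeAlgebra Matrix

/-- The defining relations of `B = k⟨x,y⟩/(x², y², xyx, yxy)`. -/
inductive BRel (k : Type*) [Field k] : FreeAlgebra k (Fin 2) → FreeAlgebra k (Fin 2) → Prop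
  | xx : BRel k (ι k 0 * ι k 0) 0
  | yy : BRel k (ι k 1 * ι k 1) 0
  | xyx : BRel k (ι k 0 * ι k 1 * ι k 0) 0
  | yxy : BRel k (ι k 1 * ι k 0 * ι k 1) 0

/-- The algebra `B = k⟨x,y⟩/(x², y², xyx, yxy)`. -/
abbrev B (k : Type*) [Field k] := RingQuot (BRel k)

/-- The image of the generator `x` in `B`. -/
def Bx (k : Type*) [Field k] : B k := RingQuot.mkAlgHom k (BRel k) (ι k 0)

/-- The image of the generator `y` in `B`. -/
def By (k : Type*) [Field k] : B k := RingQuot.mkAlgHom k (BRel k) (ι k 1)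

/-- The element `w = xy - q·yx` of `B`. -/
def wB (k : Type*) [Field k] (q : k) : B k := Bx k * By k - q • (By k * Bx k)
set_option maxSynthPendingDepth 3

/-- The relation generating the two-sided ideal `(w)` of `B`. -/
inductive ARel (k : Type*) [Field k] (q : k) : B k → B k → Prop
  | w : ARel k q (wB k q) 0

/-- The quantum complete intersection `A = B/(w)`. -/
abbrev Aalg (k : Type*) [Field k] (q : k) := RingQuot (ARel k q)

/-- The quotient map `B → A = B/(w)`. -/
def piA (k : Type*) [Field k] (q : k) : B k →ₐ[k] Aalg k q :=
  RingQuot.mkAlgHom k (ARel k q)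

/-- The image of `x` in `A`. -/
def Ax (k : Type*) [Field k] (q : k) : Aalg k q := piA k q (Bx k)

/-- The image of `y` in `A`. -/
def Ay (k : Type*) [Field k] (q : k) : Aalg k q := piA k q (By k)

/-- Regard a matrix over `k` as a matrix over `B` via the structure map. -/
def matB (k : Type*) [Field k] {r : ℕ} (M : Matrix (Fin r) (Fin r) k) :
    Matrix (Fin r) (Fin r) (B k) :=
  M.map (algebraMap k (B k))

/-- The `n × n` Jordan block with eigenvalue `l` (`l` on the diagonal, `1` on the
superdiagonal). -/
def jordan (k : Type*) [Field k] (n : ℕ) (l : k) : Matrix (Fin n) (Fin n) k :=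
  Matrix.of fun i j => if (j : ℕ) = (i : ℕ) then l else if (j : ℕ) = (i : ℕ) + 1 then 1 else 0

/-- The image (as a `k`-subspace of `Aʳ`) of right multiplication of row vectors by a
matrix `M` over `A`. -/
def imageM (k : Type*) [Field k] (q : k) {r : ℕ} (M : Matrix (Fin r) (Fin r) (Aalg k q)) :
    Submodule k (Fin r → Aalg k q) :=
  Submodule.span k (Set.range fun u : Fin r → Aalg k q => u ᵥ* M)

section QuantumPlane

variable (k : Type*) [Field k]

lemma Bx_mul_Bx : Bx k * Bx k = 0 := by
  simpa [Bx] using RingQuot.mkAlgHom_rel k (BRel.xx (k := k))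

lemma By_mul_By : By k * By k = 0 := by
  simpa [By] using RingQuot.mkAlgHom_rel k (BRel.yy (k := k))

lemma Bx_mul_By_mul_Bx : Bx k * (By k * Bx k) = 0 := by
  simpa [Bx, By, mul_assoc] using RingQuot.mkAlgHom_rel k (BRel.xyx (k := k))

lemma By_mul_Bx_mul_By : By k * (Bx k * By k) = 0 := by
  simpa [Bx, By, mul_assoc] using RingQuot.mkAlgHom_rel k (BRel.yxy (k := k))

/-- The action of `x` in a four-dimensional representation of `B`. -/
def repX (a : k) : Matrix (Fin 4) (Fin 4) k :=
  !![0, 0, 0, 0; 1, 0, 0, 0; 0, 0, 0, 0; 0, 0, a, 0]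

/-- The action of `y` in a four-dimensional representation of `B`. -/
def repY (b : k) : Matrix (Fin 4) (Fin 4) k :=
  !![0, 0, 0, 0; 0, 0, 0, 0; 1, 0, 0, 0; 0, b, 0, 0]

/-- A family of four-dimensional representations of `B` in which `xy` and `yx` act by
arbitrary multiples `a` and `b` of the same matrix unit. -/
def repB (a b : k) : B k →ₐ[k] Matrix (Fin 4) (Fin 4) k :=
  RingQuot.liftAlgHom k ⟨FreeAlgebra.lift k ![repX k a, repY k b], by
    intro u v h
    cases h <;> ext i j <;> fin_cases i <;> fin_cases j <;>
      simp [repX, repY, Matrix.mul_apply, Fin.sum_univ_four]⟩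

lemma repB_Bx (a b : k) : repB k a b (Bx k) = repX k a := by
  simp [repB, Bx]

lemma repB_By (a b : k) : repB k a b (By k) = repY k b := by
  simp [repB, By]

lemma repB_xy (a b : k) : repB k a b (Bx k * By k) 3 0 = a := by
  rw [map_mul, repB_Bx, repB_By]
  simp [repX, repY, Matrix.mul_apply, Fin.sum_univ_four]

lemma repB_yx (a b : k) : repB k a b (By k * Bx k) 3 0 = b := by
  rw [map_mul, repB_Bx, repB_By]
  simp [repX, repY, Matrix.mul_apply, Fin.sum_univ_four]

lemma piA_xy_ne_zero {q : k} (hq : q ≠ 0) : piA k q (Bx k * By k) ≠ 0 := by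
  -- The representation `repB k q 1` factors through `A`.
  let φ : Aalg k q →ₐ[k] Matrix (Fin 4) (Fin 4) k :=
    RingQuot.liftAlgHom k ⟨repB k q 1, by
      rintro _ _ ⟨⟩
      rw [wB, map_sub, map_smul, map_mul, map_mul, map_zero, repB_Bx, repB_By]
      ext i j
      fin_cases i <;> fin_cases j <;> simp [repX, repY]⟩
  have hφ (b : B k) : φ (piA k q b) = repB k q 1 b := by simp [φ, piA]
  intro h
  apply hq
  rw [← repB_xy k q 1, ← hφ, h]
  simp

/-- Every element of `B` is a combination of `1, x, y, xy, yx`. -/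
lemma exists_coords (b : B k) : ∃ c s t p p' : k,
    b = c • 1 + s • Bx k + t • By k + p • (Bx k * By k) + p' • (By k * Bx k) := by
  obtain ⟨f, rfl⟩ := RingQuot.mkAlgHom_surjective k (BRel k) b
  suffices H : ∀ b : B k, (∃ c s t p p' : k,
      b = c • 1 + s • Bx k + t • By k + p • (Bx k * By k) + p' • (By k * Bx k)) →
      ∃ c s t p p' : k, RingQuot.mkAlgHom k (BRel k) f * b =
        c • 1 + s • Bx k + t • By k + p • (Bx k * By k) + p' • (By k * Bx k) by
    simpa using H 1 ⟨1, 0, 0, 0, 0, by simp⟩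
  induction f using FreeAlgebra.induction with
  | grade0 r =>
    rintro _ ⟨c, s, t, p, p', rfl⟩
    refine ⟨r * c, r * s, r * t, r * p, r * p', ?_⟩
    rw [AlgHom.commutes, ← Algebra.smul_def]
    simp only [smul_add, smul_smul]
  | grade1 i =>
    rintro _ ⟨c, s, t, p, p', rfl⟩
    fin_cases i
    · refine ⟨0, c, 0, t, 0, ?_⟩
      change Bx k * _ = _
      simp [mul_add, Bx_mul_Bx, ← mul_assoc (Bx k) (Bx k), Bx_mul_By_mul_Bx]
    · refine ⟨0, 0, c, 0, s, ?_⟩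
      change By k * _ = _
      simp [mul_add, By_mul_By, ← mul_assoc (By k) (By k), By_mul_Bx_mul_By]
  | mul f g hf hg =>
    intro b hb
    rw [map_mul, mul_assoc]
    exact hf _ (hg b hb)
  | add f g hf hg =>
    intro b hb
    obtain ⟨c, s, t, p, p', h⟩ := hf b hb
    obtain ⟨d, s', t', u, u', h'⟩ := hg b hb
    refine ⟨c + d, s + s', t + t', p + u, p' + u', ?_⟩
    rw [map_add, add_mul, h, h']
    module

lemma exists_coords_of_mem_span {b : B k}
    (h : b ∈ Submodule.span k ({Bx k, By k, Bx k * By k, By k * Bx k} : Set (B k))) :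
    ∃ s t p p' : k,
      b = s • Bx k + t • By k + p • (Bx k * By k) + p' • (By k * Bx k) := by
  simp only [Submodule.mem_span_insert, Submodule.mem_span_singleton] at h
  obtain ⟨s, _, ⟨t, _, ⟨p, _, ⟨p', rfl⟩, rfl⟩, rfl⟩, rfl⟩ := h
  exact ⟨s, t, p, p', by abel⟩

lemma coords_mul_coords (s t p p' s₁ t₁ p₁ p₁' : k) :
    (s • Bx k + t • By k + p • (Bx k * By k) + p' • (By k * Bx k)) *
      (s₁ • Bx k + t₁ • By k + p₁ • (Bx k * By k) + p₁' • (By k * Bx k)) =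
    (s * t₁) • (Bx k * By k) + (t * s₁) • (By k * Bx k) := by
  have hxx := Bx_mul_Bx k
  have hyy := By_mul_By k
  have hxyx := Bx_mul_By_mul_Bx k
  have hyxy := By_mul_Bx_mul_By k
  have hxx' (b : B k) : Bx k * (Bx k * b) = 0 := by rw [← mul_assoc, hxx, zero_mul]
  have hyy' (b : B k) : By k * (By k * b) = 0 := by rw [← mul_assoc, hyy, zero_mul]
  simp only [mul_add, add_mul, smul_mul_assoc, mul_smul_comm, mul_assoc, hxx, hyy, hxyx, hyxy,
    hxx', hyy', mul_zero, smul_zero, add_zero, zero_add, smul_smul]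
  module

lemma Bx_mul_coords_mul_coords (c s t p p' s₁ t₁ p₁ p₁' : k) :
    Bx k * ((c • 1 + s • Bx k + t • By k + p • (Bx k * By k) + p' • (By k * Bx k)) *
      (s₁ • Bx k + t₁ • By k + p₁ • (Bx k * By k) + p₁' • (By k * Bx k))) =
    (c * t₁) • (Bx k * By k) := by
  have h : Bx k * (c • 1 + s • Bx k + t • By k + p • (Bx k * By k) + p' • (By k * Bx k)) =
      c • Bx k + (0 : k) • By k + t • (Bx k * By k) + (0 : k) • (By k * Bx k) := by
    simp [mul_add, Bx_mul_Bx, ← mul_assoc (Bx k) (Bx k), Bx_mul_By_mul_Bx]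
  rw [← mul_assoc, h, coords_mul_coords]
  simp

lemma By_mul_coords_mul_coords (c s t p p' s₁ t₁ p₁ p₁' : k) :
    By k * ((c • 1 + s • Bx k + t • By k + p • (Bx k * By k) + p' • (By k * Bx k)) *
      (s₁ • Bx k + t₁ • By k + p₁ • (Bx k * By k) + p₁' • (By k * Bx k))) =
    (c * s₁) • (By k * Bx k) := by
  have h : By k * (c • 1 + s • Bx k + t • By k + p • (Bx k * By k) + p' • (By k * Bx k)) =
      (0 : k) • Bx k + c • By k + (0 : k) • (Bx k * By k) + s • (By k * Bx k) := by
    simp [mul_add, By_mul_By, ← mul_assoc (By k) (By k), By_mul_Bx_mul_By]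
  rw [← mul_assoc, h, coords_mul_coords]
  simp

lemma exists_of_mem_imageM {q : k} {r : ℕ} {M : Matrix (Fin r) (Fin r) (Aalg k q)}
    {m : Fin r → Aalg k q} (h : m ∈ imageM k q M) : ∃ u : Fin r → Aalg k q, u ᵥ* M = m := by
  induction h using Submodule.span_induction with
  | mem m h => exact h
  | zero => exact ⟨0, zero_vecMul M⟩
  | add m m' _ _ h h' =>
    obtain ⟨u, rfl⟩ := h
    obtain ⟨u', rfl⟩ := h'
    exact ⟨u + u', add_vecMul M u u'⟩
  | smul a m _ h =>
    obtain ⟨u, rfl⟩ := h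
    exact ⟨a • u, smul_vecMul a u M⟩

/-- On the image of right multiplication by `C`, the kernel of `x` is contained in that of `y`,
as soon as `C` has a left cofactor `D` of `w`. -/
lemma Ay_smul_eq_zero_of_Ax_smul_eq_zero {q : k} (hq : q ≠ 0) {r : ℕ}
    {C D : Matrix (Fin r) (Fin r) (B k)}
    (hC : ∀ i j, C i j ∈
      Submodule.span k ({Bx k, By k, Bx k * By k, By k * Bx k} : Set (B k)))
    (hD : ∀ i j, D i j ∈
      Submodule.span k ({Bx k, By k, Bx k * By k, By k * Bx k} : Set (B k)))
    (hDC : D * C = wB k q • (1 : Matrix (Fin r) (Fin r) (B k)))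
    {m : Fin r → Aalg k q} (hm : m ∈ imageM k q (C.map ⇑(piA k q)))
    (hx : Ax k q • m = 0) : Ay k q • m = 0 := by
  choose C₁ C₂ C₃ C₄ hC using fun i j => exists_coords_of_mem_span k (hC i j)
  choose D₁ D₂ D₃ D₄ hD using fun i j => exists_coords_of_mem_span k (hD i j)
  have hinv : Matrix.of D₁ * Matrix.of C₂ = 1 := by
    ext i j
    have h := congrArg (fun b => repB k 1 0 b 3 0) (congrFun (congrFun hDC i) j)
    simp only [Matrix.mul_apply, hC, hD, coords_mul_coords, map_sum, map_add, map_smul,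
      Matrix.sum_apply, Matrix.add_apply, Matrix.smul_apply, repB_xy, repB_yx] at h
    have hw : repB k 1 0 (wB k q) 3 0 = 1 := by
      rw [wB, map_sub, map_smul, Matrix.sub_apply, Matrix.smul_apply, repB_xy, repB_yx]
      simp
    by_cases hij : i = j
    · subst hij
      simpa [Matrix.mul_apply, hw] using h
    · simpa [Matrix.mul_apply, hij] using h
  obtain ⟨u, rfl⟩ := exists_of_mem_imageM k hm
  choose b hb using fun l => RingQuot.mkAlgHom_surjective k (ARel k q) (u l)
  choose c s t p p' hb' using fun l => exists_coords k (b l)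
  have hu (l) : u l = piA k q (b l) := (hb l).symm
  have hentry (a : B k) (j) : (piA k q a • (u ᵥ* C.map ⇑(piA k q))) j =
      piA k q (∑ l, a * (b l * C l j)) := by
    simp [Matrix.vecMul, dotProduct, hu, Finset.mul_sum]
  have hc : c = 0 := by
    have h0 : c ᵥ* Matrix.of C₂ = 0 := by
      ext j
      have h := congrFun hx j
      rw [Ax, hentry] at h
      simp only [hC, hb', Bx_mul_coords_mul_coords, ← Finset.sum_smul, map_smul,
        Pi.zero_apply] at h
      simpa [Matrix.vecMul, dotProduct] using
        (smul_eq_zero.mp h).resolve_right (piA_xy_ne_zero k hq)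
    calc c = c ᵥ* (Matrix.of C₂ * Matrix.of D₁) := by
          rw [mul_eq_one_comm.mp hinv, vecMul_one]
      _ = 0 := by rw [← vecMul_vecMul, h0, zero_vecMul]
  ext j
  rw [Ay, hentry]
  simp only [hC, hb', By_mul_coords_mul_coords, hc]
  simp

end QuantumPlane

theorem stmt16 (k : Type*) [Field k] [IsAlgClosed k] (q : k) (hq : q ≠ 0)
    (ν : B k ≃ₐ[k] B k)
    (hνx : ν (Bx k) = -(q⁻¹ • Bx k)) (hνy : ν (By k) = -(q • By k))
    (n : ℕ) (hn : 1 ≤ n) :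
    ¬ ∃ (r : ℕ) (_ : 1 ≤ r) (C D : Matrix (Fin r) (Fin r) (B k)),
      (∀ i j, C i j ∈
        Submodule.span k ({Bx k, By k, Bx k * By k, By k * Bx k} : Set (B k))) ∧
      (∀ i j, D i j ∈
        Submodule.span k ({Bx k, By k, Bx k * By k, By k * Bx k} : Set (B k))) ∧
      C.map ⇑ν * D = wB k q • (1 : Matrix (Fin r) (Fin r) (B k)) ∧
      D * C = wB k q • (1 : Matrix (Fin r) (Fin r) (B k)) ∧
      ∃ e : (Fin n ⊕ Fin n → k) ≃ₗ[k] imageM k q (C.map ⇑(piA k q)),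
        (∀ v : Fin n ⊕ Fin n → k,
          (e (Matrix.fromBlocks 0 (jordan k n 0) 0 0 *ᵥ v) : Fin r → Aalg k q) =
            Ax k q • (e v : Fin r → Aalg k q)) ∧
        (∀ v : Fin n ⊕ Fin n → k,
          (e (Matrix.fromBlocks 0 1 0 0 *ᵥ v) : Fin r → Aalg k q) =
            Ay k q • (e v : Fin r → Aalg k q)) := by
  rintro ⟨r, -, C, D, hC, hD, -, hDC, e, hex, hey⟩
  let v : Fin n ⊕ Fin n → k := Sum.elim 0 (Pi.single ⟨0, hn⟩ 1)
  have hJ : jordan k n 0 *ᵥ Pi.single ⟨0, hn⟩ 1 = 0 := by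
    ext i
    simp [jordan]
  have hv : Matrix.fromBlocks 0 (jordan k n 0) 0 0 *ᵥ v = (0 : Fin n ⊕ Fin n → k) := by
    rw [Matrix.fromBlocks_mulVec, Sum.elim_comp_inr, hJ]
    ext (i | i) <;> simp
  have hx : Ax k q • (e v : Fin r → Aalg k q) = 0 := by
    rw [← hex, hv, map_zero, ZeroMemClass.coe_zero]
  have hy := Ay_smul_eq_zero_of_Ax_smul_eq_zero k hq hC hD hDC (e v).2 hx
  rw [← hey, ZeroMemClass.coe_eq_zero, LinearEquiv.map_eq_zero_iff,
    Matrix.fromBlocks_mulVec] at hy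
  simpa [v] using congrFun hy (Sum.inl ⟨0, hn⟩)
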